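/- arXiv:1011.1032 — 4 statements merged into one kernel-verified Lean document; each statement's English description precedes it below -/
import Mathlib

section
/- Let G be a group and H ≤ K ≤ G subgroups. The following are equivalent: (i) for every g ∈ G, if there is a finite set F ⊆ G with Hg ⊆ FH then g ∈ K; (ii) for every g ∈ G \ K and every nonempty finite set F ⊆ G \ K, there exists h ∈ H such that Fhg ∩ H = ∅ (i.e. g' h g ∉ H for all g' ∈ F). -/
open scoped Pointwise

/-- The one-sided quasi-normalizer of `H` in `G`: the set of `g ∈ G` such that
`Hg ⊆ FH` for some finite `F ⊆ G`. -/
def qnorm1 {G : Type*} [Group G] (H : Subgroup G) : Set G :=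
  {g | ∃ F : Set G, F.Finite ∧ ((· * g) '' (H : Set G)) ⊆ F * (H : Set G)}

/-- The one-sided quasi-normalizer of `H` is contained in `K` iff for every
`g ∈ G \ K` and every nonempty finite `F ⊆ G \ K` there is `h ∈ H` with
`Fhg ∩ H = ∅`. -/
theorem qnorm1_subset_iff_avoid {G : Type*} [Group G] (H K : Subgroup G) (hHK : H ≤ K) :
    qnorm1 H ⊆ (K : Set G) ↔
      ∀ g : G, g ∉ K → ∀ F : Finset G, F.Nonempty → (∀ x ∈ F, x ∉ K) →
        ∃ h ∈ H, ∀ g' ∈ F, g' * h * g ∉ H := by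
  classical
  constructor
  · intro hsub g hg F _ _
    by_contra! hcon
    refine hg (hsub ⟨(F : Set G)⁻¹, F.finite_toSet.inv, ?_⟩)
    rintro _ ⟨h, hh, rfl⟩
    obtain ⟨x, hxF, hx⟩ := hcon h hh
    exact ⟨x⁻¹, Set.inv_mem_inv.mpr hxF, x * h * g, hx, by group⟩
  · rintro havoid g ⟨F, hF, hcover⟩
    by_contra hg
    have hcoset : ∀ h ∈ H, ∃ f ∈ F, f ∉ K ∧ f⁻¹ * h * g ∈ H := by
      intro h hh
      obtain ⟨f, hf, k, hk, hfk⟩ := hcover ⟨h, hh, rfl⟩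
      have hfk : f * k = h * g := hfk
      refine ⟨f, hf, fun hfK => hg ?_, ?_⟩
      · have hmem : h * g ∈ K := hfk ▸ K.mul_mem hfK (hHK hk)
        exact (K.mul_mem_cancel_left (hHK hh)).mp hmem
      · rwa [mul_assoc, ← hfk, inv_mul_cancel_left]
    let E : Finset G := (hF.toFinset.filter (· ∉ K)).image (·⁻¹)
    have hE : ∀ f ∈ F, f ∉ K → f⁻¹ ∈ E := fun f hf hfK =>
      Finset.mem_image_of_mem _ (Finset.mem_filter.mpr ⟨hF.mem_toFinset.mpr hf, hfK⟩)
    have hEK : ∀ x ∈ E, x ∉ K := by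
      intro x hx
      obtain ⟨f, hf, rfl⟩ := Finset.mem_image.mp hx
      exact fun hfK => (Finset.mem_filter.mp hf).2 (K.inv_mem_iff.mp hfK)
    obtain ⟨f₁, hf₁, hf₁K, _⟩ := hcoset 1 H.one_mem
    obtain ⟨h, hh, hdisj⟩ := havoid g hg E ⟨f₁⁻¹, hE f₁ hf₁ hf₁K⟩ hEK
    obtain ⟨f, hf, hfK, hfH⟩ := hcoset h hh
    exact hdisj f⁻¹ (hE f hf hfK) hfH
end

section
/- Let G be a group and H ≤ K ≤ G subgroups. If for every nonempty finite set F ⊆ G \ K there exists h ∈ H with FhF ∩ H = ∅, then the one-sided quasi-normalizer of H in G is contained in K; that is, whenever g ∈ G and F' ⊆ G is a finite set with Hg ⊆ F'H, one has g ∈ K. -/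
open scoped Pointwise

/-- If for every nonempty finite `F ⊆ G \ K` there is `h ∈ H` with `FhF ∩ H = ∅`,
then the one-sided quasi-normalizer of `H` in `G` is contained in `K`. -/
theorem qnorm1_subset_of_avoid {G : Type*} [Group G] (H K : Subgroup G) (hHK : H ≤ K)
    (hyp : ∀ F : Finset G, F.Nonempty → (∀ x ∈ F, x ∉ K) →
      ∃ h ∈ H, ∀ g ∈ F, ∀ g' ∈ F, g * h * g' ∉ H) :
    qnorm1 H ⊆ (K : Set G) := by
  classical
  rintro g ⟨F, hF, hsub⟩
  by_contra hg
  obtain ⟨h, hh, hav⟩ := hyp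
    (insert g ((hF.toFinset.image (·⁻¹)).filter (· ∉ K)))
    (Finset.insert_nonempty _ _)
    (by
      intro x hx
      rcases Finset.mem_insert.mp hx with rfl | hx
      · exact hg
      · exact (Finset.mem_filter.mp hx).2)
  obtain ⟨f, hf, k, hk, hfk⟩ := Set.mem_mul.mp (hsub ⟨h, hh, rfl⟩)
  replace hfk : f * k = h * g := hfk
  have hfK : f⁻¹ ∉ K := by
    intro hfK
    refine hg ((K.mul_mem_cancel_left (hHK hh)).mp ?_)
    rw [← hfk]
    exact K.mul_mem (K.inv_mem_iff.mp hfK) (hHK hk)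
  refine hav f⁻¹ ?_ g (Finset.mem_insert_self _ _) ?_
  · exact Finset.mem_insert_of_mem (Finset.mem_filter.mpr
      ⟨Finset.mem_image_of_mem _ (hF.mem_toFinset.mpr hf), hfK⟩)
  · rw [mul_assoc, ← hfk, inv_mul_cancel_left]
    exact hk
end

section
/- Let G be a group and H ≤ K ≤ G subgroups. The following are equivalent: (i) the one-sided quasi-normalizer of H in G is contained in K, i.e. whenever g ∈ G and F ⊆ G is finite with Hg ⊆ FH, one has g ∈ K; (ii) for every nonempty finite set F ⊆ G \ K there exists h ∈ H such that FhF ∩ H = ∅. -/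
open scoped Pointwise

/-- If the orbit of `gH` under the left action of `H` on `G ⧸ H` is finite, then `g` belongs to the
one-sided quasi-normalizer of `H`. -/
theorem mem_qnorm1_of_finite_orbit {G : Type*} [Group G] {H : Subgroup G} {g : G}
    (hg : (MulAction.orbit H (g : G ⧸ H)).Finite) : g ∈ qnorm1 H := by
  refine ⟨(fun x : G ⧸ H ↦ x.out) '' MulAction.orbit H (g : G ⧸ H), hg.image _, ?_⟩
  rintro _ ⟨h, hh, rfl⟩
  refine Set.mem_mul.2 ⟨((h * g : G) : G ⧸ H).out, ⟨_, ⟨⟨h, hh⟩, rfl⟩, rfl⟩,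
    ((h * g : G) : G ⧸ H).out⁻¹ * (h * g), ?_, by simp⟩
  exact QuotientGroup.eq.1 (Quotient.out_eq' _)

/-- If finitely many sets `{h | h • y = x}` with `(x, y) ∈ s` cover a group acting on `α`, then
one of the points `y` has finite orbit. -/
theorem exists_finite_orbit_of_forall_exists_smul_eq {M α : Type*} [Group M] [MulAction M α]
    (s : Finset (α × α)) (hs : ∀ h : M, ∃ p ∈ s, h • p.2 = p.1) :
    ∃ p ∈ s, (MulAction.orbit M p.2).Finite := by
  classical
  let c : α × α → M := fun p ↦ if hp : ∃ h : M, h • p.2 = p.1 then hp.choose else 1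
  have hc (h : M) (p : α × α) (hp : h • p.2 = p.1) : c p • p.2 = p.1 := by
    have hex : ∃ h : M, h • p.2 = p.1 := ⟨h, hp⟩
    simpa only [c, dif_pos hex] using hex.choose_spec
  obtain ⟨p, hp, hfin⟩ := Subgroup.exists_finiteIndex_of_leftCoset_cover
    (s := s) (g := c) (H := fun p ↦ MulAction.stabilizer M p.2) <| by
      refine Set.eq_univ_of_forall fun h ↦ ?_
      obtain ⟨p, hp, hhp⟩ := hs h
      refine Set.mem_iUnion₂.2 ⟨p, hp, Set.mem_smul_set_iff_inv_smul_mem.2 ?_⟩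
      rw [SetLike.mem_coe, MulAction.mem_stabilizer_iff, smul_eq_mul, mul_smul, hhp,
        inv_smul_eq_iff, hc h p hhp]
  refine ⟨p, hp, ?_⟩
  have : Finite (M ⧸ MulAction.stabilizer M p.2) := Subgroup.finite_quotient_of_finiteIndex
  exact Set.finite_coe_iff.1 <|
    Finite.of_equiv _ (MulAction.orbitEquivQuotientStabilizer M p.2).symm

/-- The one-sided quasi-normalizer of `H` in `G` is contained in `K` iff for every
nonempty finite `F ⊆ G \ K` there is `h ∈ H` with `FhF ∩ H = ∅`. -/
theorem qnorm1_subset_iff_avoid_two_sided {G : Type*} [Group G] (H K : Subgroup G)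
    (hHK : H ≤ K) :
    qnorm1 H ⊆ (K : Set G) ↔
      ∀ F : Finset G, F.Nonempty → (∀ x ∈ F, x ∉ K) →
        ∃ h ∈ H, ∀ g ∈ F, ∀ g' ∈ F, g * h * g' ∉ H := by
  classical
  constructor
  · intro hK F _ hF
    by_contra! hcon
    obtain ⟨p, hp, hfin⟩ := exists_finite_orbit_of_forall_exists_smul_eq (M := H)
      ((F ×ˢ F).image fun q ↦ (((q.1⁻¹ : G) : G ⧸ H), ((q.2 : G) : G ⧸ H))) <| by
        rintro ⟨h, hh⟩
        obtain ⟨g, hg, g', hg', hmem⟩ := hcon h hh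
        refine ⟨_, Finset.mem_image_of_mem _ (Finset.mk_mem_product hg hg'), ?_⟩
        refine Eq.symm (QuotientGroup.eq.2 ?_)
        simpa [mul_assoc] using hmem
    obtain ⟨⟨g, g'⟩, hq, rfl⟩ := Finset.mem_image.1 hp
    exact hF g' (Finset.mem_product.1 hq).2 (hK (mem_qnorm1_of_finite_orbit hfin))
  · rintro hF g ⟨F, hfin, hsub⟩
    by_contra hg
    obtain ⟨h, hh, havoid⟩ := hF
      (insert g ((hfin.toFinset.filter (· ∉ K)).image (·⁻¹))) (Finset.insert_nonempty _ _) (by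
        intro x hx
        rcases Finset.mem_insert.1 hx with rfl | hx
        · exact hg
        · obtain ⟨f, hf, rfl⟩ := Finset.mem_image.1 hx
          simpa using (Finset.mem_filter.1 hf).2)
    obtain ⟨f, hf, h', hh', heq⟩ := Set.mem_mul.1 (hsub ⟨h, hh, rfl⟩)
    replace heq : f * h' = h * g := heq
    have hfK : f ∉ K := fun hfK ↦ hg <| (K.mul_mem_cancel_left (hHK hh)).1 <|
      heq ▸ K.mul_mem hfK (hHK hh')
    refine havoid f⁻¹ (Finset.mem_insert_of_mem (Finset.mem_image_of_mem _
      (Finset.mem_filter.2 ⟨hfin.mem_toFinset.2 hf, hfK⟩))) g (Finset.mem_insert_self _ _) ?_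
    rw [mul_assoc, ← heq, inv_mul_cancel_left]
    exact hh'
end

section
/- Let G be a group and H ≤ G a subgroup. The one-sided quasi-normalizer qN_G^{(1)}(H) is contained in H if and only if for every nonempty finite set F ⊆ G \ H there exists h ∈ H such that FhF ∩ H = ∅ (i.e. g h g' ∉ H for all g, g' ∈ F). -/
open scoped Pointwise

theorem mem_qnorm1_of_finiteIndex_stabilizer {G : Type*} [Group G] {H : Subgroup G} {g : G}
    (hg : (MulAction.stabilizer H (g : G ⧸ H)).FiniteIndex) : g ∈ qnorm1 H := by
  have horb : (MulAction.orbit H (g : G ⧸ H)).Finite :=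
    Set.finite_coe_iff.mp
      (Finite.of_equiv _ (MulAction.orbitEquivQuotientStabilizer H (g : G ⧸ H)).symm)
  refine ⟨(fun q : G ⧸ H ↦ q.out) '' MulAction.orbit H (g : G ⧸ H), horb.image _, ?_⟩
  rintro _ ⟨h, hh, rfl⟩
  refine Set.mem_mul.mpr ⟨((h * g : G) : G ⧸ H).out,
    Set.mem_image_of_mem _ ⟨⟨h, hh⟩, rfl⟩, _, ?_, mul_inv_cancel_left _ _⟩
  exact QuotientGroup.eq.mp (QuotientGroup.out_eq' _)

theorem exists_mem_qnorm1_of_forall_mul_mul_mem {G : Type*} [Group G] {H : Subgroup G}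
    {F : Finset G} (hF : ∀ h ∈ H, ∃ g ∈ F, ∃ g' ∈ F, g * h * g' ∈ H) :
    ∃ g ∈ F, g ∈ qnorm1 H := by
  classical
  have hc : ∀ p : G × G, ∃ c : H, (∃ h : H, p.1 * h * p.2 ∈ H) → p.1 * c * p.2 ∈ H := fun p ↦ by
    by_cases hp : ∃ h : H, p.1 * h * p.2 ∈ H
    · exact hp.imp fun _ hh _ ↦ hh
    · exact ⟨1, fun h ↦ absurd h hp⟩
  choose c hc using hc
  obtain ⟨p, hp, hfin⟩ := Subgroup.exists_finiteIndex_of_leftCoset_cover (s := F ×ˢ F) (g := c)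
    (H := fun p ↦ MulAction.stabilizer H (p.2 : G ⧸ H)) <| by
      refine Set.iUnion₂_eq_univ_iff.mpr fun h ↦ ?_
      obtain ⟨g, hg, g', hg', hmem⟩ := hF h h.2
      refine ⟨(g, g'), Finset.mk_mem_product hg hg', ?_⟩
      rw [mem_leftCoset_iff, SetLike.mem_coe, MulAction.mem_stabilizer_iff, mul_smul,
        inv_smul_eq_iff]
      refine QuotientGroup.eq.mpr ?_
      have := H.mul_mem (H.inv_mem hmem) (hc (g, g') ⟨h, hmem⟩)
      simpa [Subgroup.smul_def, mul_assoc] using this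
  exact ⟨p.2, (Finset.mem_product.mp hp).2, mem_qnorm1_of_finiteIndex_stabilizer hfin⟩

/-- `qN_G^{(1)}(H) ⊆ H` iff for every nonempty finite `F ⊆ G \ H` there is `h ∈ H`
with `FhF ∩ H = ∅`. -/
theorem qnorm1_subset_self_iff_avoid {G : Type*} [Group G] (H : Subgroup G) :
    qnorm1 H ⊆ (H : Set G) ↔
      ∀ F : Finset G, F.Nonempty → (∀ x ∈ F, x ∉ H) →
        ∃ h ∈ H, ∀ g ∈ F, ∀ g' ∈ F, g * h * g' ∉ H := by
  classical
  constructor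
  · intro hsub F _ hFH
    by_contra! hF
    obtain ⟨g, hgF, hg⟩ := exists_mem_qnorm1_of_forall_mul_mul_mem hF
    exact hFH g hgF (hsub hg)
  · rintro havoid g ⟨F, hfin, hF⟩
    by_contra hg
    have hg : g ∉ H := hg
    obtain ⟨h, hh, hmem⟩ := havoid (insert g ((hfin.toFinset.filter (· ∉ H)).image (·⁻¹)))
      (Finset.insert_nonempty _ _) (by
        intro x hx
        rcases Finset.mem_insert.mp hx with rfl | hx
        · exact hg
        · obtain ⟨f, hf, rfl⟩ := Finset.mem_image.mp hx
          simpa using (Finset.mem_filter.mp hf).2)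
    obtain ⟨f, hf, k, hk, hfk⟩ := Set.mem_mul.mp (hF ⟨h, hh, rfl⟩)
    have hk : k ∈ H := hk
    have hfk : f * k = h * g := hfk
    have hfH : f ∉ H := fun hfH ↦ hg <|
      (H.mul_mem_cancel_left hh).mp (hfk ▸ H.mul_mem hfH hk)
    refine hmem f⁻¹ (Finset.mem_insert_of_mem (Finset.mem_image_of_mem _ ?_)) g
      (Finset.mem_insert_self _ _) ?_
    · simp [hf, hfH]
    · rwa [mul_assoc, ← hfk, inv_mul_cancel_left]
end
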